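/- arXiv:1508.04062 — 6 statements merged into one kernel-verified Lean document; each statement's English description precedes it below -/
import Mathlib

section
/- Let p be a prime and G a finite cyclic group of order pⁿ, let H ≤ K < G be subgroups, and let K⁺ be the unique subgroup of G with K < K⁺ and [K⁺ : K] = p. Consider the translation action of G on functions G/H → Bool, (g · f)(x) = f(g⁻¹ · x). Then the set of functions f : G/H → Bool whose stabilizer is exactly K has cardinality 2^[G:K] − 2^([G:K]/p), and [G:K] divides 2^[G:K] − 2^([G:K]/p). -/
theorem aux_mem_iff {G : Type*} [CommGroup G] [Finite G] [IsCyclic G] (M : Subgroup G) :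
    (powMonoidHom (Nat.card M) : G →* G).ker = M := by
  symm
  apply Subgroup.eq_of_le_of_card_ge
  · intro x hx
    rw [MonoidHom.mem_ker, powMonoidHom_apply]
    exact orderOf_dvd_iff_pow_eq_one.1 (Subgroup.orderOf_dvd_natCard M hx)
  · rw [IsCyclic.card_powMonoidHom_ker, Nat.gcd_eq_right (Subgroup.card_subgroup_dvd_card M)]

theorem aux_le_of_dvd {G : Type*} [CommGroup G] [Finite G] [IsCyclic G] (L M : Subgroup G)
    (h : Nat.card L ∣ Nat.card M) : L ≤ M := by
  rw [← aux_mem_iff M]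
  intro x hx
  rw [← aux_mem_iff L, MonoidHom.mem_ker, powMonoidHom_apply] at hx
  rw [MonoidHom.mem_ker, powMonoidHom_apply]
  obtain ⟨c, hc⟩ := h
  rw [hc, pow_mul, hx, one_pow]

/-- The functions fixed by `L`. -/
def auxFix {G : Type*} [CommGroup G] (H L : Subgroup G) : Set (G ⧸ H → Bool) :=
  {f | ∀ g ∈ L, ∀ x : G ⧸ H, f (g⁻¹ • x) = f x}

theorem auxFix_ncard {G : Type*} [CommGroup G] [Finite G] (H L : Subgroup G) (h : H ≤ L) :
    (auxFix H L).ncard = 2 ^ L.index := by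
  have e : (auxFix H L) ≃ (G ⧸ L → Bool) :=
    { toFun := fun f => Quotient.lift (fun a : G => f.1 (a : G ⧸ H)) (by
        intro a b hab
        have hab' : a⁻¹ * b ∈ L := QuotientGroup.leftRel_apply.mp hab
        have := f.2 (a⁻¹ * b) hab' (b : G ⧸ H)
        rw [← this]
        show f.1 (a : G ⧸ H) = f.1 (((a⁻¹ * b)⁻¹ * b : G) : G ⧸ H)
        simp [mul_comm])
      invFun := fun f => ⟨fun x => f (Subgroup.quotientMapOfLE h x), by
        intro g hg x
        induction x using QuotientGroup.induction_on with
        | H a =>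
          show f ((g⁻¹ * a : G) : G ⧸ L) = f ((a : G) : G ⧸ L)
          congr 1
          rw [QuotientGroup.eq]
          simpa [mul_comm, mul_assoc] using hg⟩
      left_inv := by
        intro f
        ext x
        induction x using QuotientGroup.induction_on with
        | H a => rfl
      right_inv := by
        intro f
        ext x
        induction x using QuotientGroup.induction_on with
        | H a => rfl }
  rw [← Nat.card_coe_set_eq, Nat.card_congr e, Nat.card_fun]
  simp [Subgroup.index]

/-- The stabilizer of `f`. -/
def auxStab {G : Type*} [CommGroup G] (H : Subgroup G) (f : G ⧸ H → Bool) : Subgroup G where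
  carrier := {g | ∀ x : G ⧸ H, f (g⁻¹ • x) = f x}
  one_mem' := by intro x; simp
  mul_mem' := by
    intro a b ha hb x
    rw [mul_inv, mul_smul, ha, hb]
  inv_mem' := by
    intro a ha x
    rw [← ha, smul_smul, mul_inv_cancel, one_smul]

/-- Let `G` be a finite cyclic group of order `p ^ n` (`p` prime) and `H ≤ K < G` subgroups,
with `G` acting on functions `G ⧸ H → Bool` by translation `(g • f) x = f (g⁻¹ • x)`.
The set of functions whose stabilizer is exactly `K` has cardinality
`2 ^ [G:K] - 2 ^ ([G:K] / p)`, and `[G:K]` divides this number. -/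
theorem stmt_3 {G : Type*} [CommGroup G] [Finite G] [IsCyclic G] (p n : ℕ)
    (hp : p.Prime) (hG : Nat.card G = p ^ n) (H K : Subgroup G) (hHK : H ≤ K)
    (hK : K < ⊤) :
    Nat.card {f : G ⧸ H → Bool // ∀ g : G, (∀ x : G ⧸ H, f (g⁻¹ • x) = f x) ↔ g ∈ K}
      = 2 ^ K.index - 2 ^ (K.index / p) ∧
    K.index ∣ 2 ^ K.index - 2 ^ (K.index / p) := by
  have hm : ∃ m, K.index = p ^ (m + 1) := by
    obtain ⟨m, -, hm⟩ := (Nat.dvd_prime_pow hp).1 (hG ▸ K.index_dvd_card)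
    cases m with
    | zero => exact absurd (Subgroup.index_eq_one.1 (by simpa using hm)) hK.ne
    | succ m => exact ⟨m, hm⟩
  obtain ⟨m, hm⟩ := hm
  have hdiv : K.index / p = p ^ m := by
    rw [hm, pow_succ, Nat.mul_div_cancel _ hp.pos]
  refine ⟨?_, ?_⟩
  · have hcard := K.card_mul_index
    have hKpos : 0 < Nat.card K := Nat.card_pos
    set L : Subgroup G := (powMonoidHom (p * Nat.card K) : G →* G).ker with hL
    have hLcard : Nat.card L = p * Nat.card K := by
      rw [hL, IsCyclic.card_powMonoidHom_ker, Nat.gcd_eq_right]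
      exact ⟨p ^ m, by rw [← hcard, hm]; ring⟩
    have hLidx : L.index = K.index / p := by
      rw [hdiv]
      have h2 := L.card_mul_index
      rw [hLcard, ← hcard, hm] at h2
      apply Nat.eq_of_mul_eq_mul_left (Nat.mul_pos hp.pos hKpos)
      rw [h2]; ring
    have hKL : K ≤ L := aux_le_of_dvd K L (by rw [hLcard]; exact Dvd.intro_left _ rfl)
    have hset : {f : G ⧸ H → Bool | ∀ g : G, (∀ x : G ⧸ H, f (g⁻¹ • x) = f x) ↔ g ∈ K}
        = auxFix H K \ auxFix H L := by
      ext f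
      constructor
      · intro hf
        refine ⟨fun g hg => (hf g).2 hg, fun hfL => ?_⟩
        have hLK : L ≤ K := fun g hg => (hf g).1 (hfL g hg)
        have := Subgroup.card_le_of_le hLK
        rw [hLcard] at this
        have := hp.two_le
        nlinarith
      · rintro ⟨h1, h2⟩ g
        refine ⟨fun hg => ?_, h1 g⟩
        by_contra hgK
        apply h2
        have hKS : K ≤ auxStab H f := h1
        suffices hLS : L ≤ auxStab H f from hLS
        apply aux_le_of_dvd
        rw [hLcard]
        have hne : Nat.card K ≠ Nat.card (auxStab H f) := fun heq =>
          hgK ((Subgroup.eq_of_le_of_card_ge hKS heq.ge) ▸ (show g ∈ auxStab H f from hg))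
        have hd := Subgroup.card_dvd_of_le hKS
        obtain ⟨a, -, ha⟩ := (Nat.dvd_prime_pow hp).1 (hG ▸ K.card_subgroup_dvd_card)
        obtain ⟨b, -, hb⟩ := (Nat.dvd_prime_pow hp).1
          (hG ▸ (auxStab H f).card_subgroup_dvd_card)
        rw [ha, hb] at hd hne
        rw [ha, hb, ← pow_succ']
        apply pow_dvd_pow
        have hab := (Nat.pow_dvd_pow_iff_le_right hp.one_lt).1 hd
        have : a ≠ b := fun h => hne (by rw [h])
        omega
    have hsub : auxFix H L ⊆ auxFix H K := fun f hf g hg => hf g (hKL hg)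
    rw [← hLidx, ← auxFix_ncard H K hHK, ← auxFix_ncard H L (hHK.trans hKL),
      ← Set.ncard_sdiff hsub (Set.toFinite _), ← hset]
    rfl
  · rw [hdiv, hm]
    have : Fact p.Prime := ⟨hp⟩
    have h1 : (p : ℤ) ∣ 2 ^ p - 2 := by
      rw [← ZMod.intCast_zmod_eq_zero_iff_dvd]
      push_cast
      rw [ZMod.pow_card, sub_self]
    have h2 := dvd_sub_pow_of_dvd_sub h1 m
    rw [← pow_mul, ← pow_succ'] at h2
    zify
    rw [Nat.cast_sub (Nat.pow_le_pow_right (by norm_num)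
      (Nat.pow_le_pow_right hp.pos (Nat.le_succ m)))]
    push_cast
    exact h2
end

section
/- Let p be a prime and G a finite cyclic group of order pⁿ, and let H' < H ≤ G be subgroups with H' a proper subgroup of H. Let Map_H(G, H/H') be the set of functions f : G → H/H' satisfying f(h·g) = h · f(g) for all h ∈ H and g ∈ G, equipped with the G-action (γ · f)(g) = f(g·γ). Then for every f in Map_H(G, H/H'), the stabilizer of f in G is exactly H'. -/
theorem mem_zpowers_of_orderOf_dvd' {G : Type*} [CommGroup G] [Finite G] [IsCyclic G] (a b : G)
    (h : orderOf a ∣ orderOf b) : a ∈ Subgroup.zpowers b := by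
  classical
  have := Fintype.ofFinite G
  have h1 := IsCyclic.card_pow_eq_one_le (α := G) (orderOf_pos b)
  have h2 : (Finset.univ.filter (fun x : G => x ∈ Subgroup.zpowers b)) ⊆
      (Finset.univ.filter (fun x : G => x ^ orderOf b = 1)) := by
    intro x hx
    simp only [Finset.mem_filter, Finset.mem_univ, true_and] at hx ⊢
    exact orderOf_dvd_iff_pow_eq_one.mp (orderOf_dvd_of_mem_zpowers hx)
  have h3 : (Finset.univ.filter (fun x : G => x ∈ Subgroup.zpowers b)).card = orderOf b := by
    rw [← Nat.card_zpowers, Nat.card_eq_fintype_card, Fintype.card_subtype]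
  have h4 := Finset.eq_of_subset_of_card_le h2 (h3 ▸ h1)
  have h5 : a ∈ (Finset.univ.filter (fun x : G => x ^ orderOf b = 1)) := by
    simpa using orderOf_dvd_iff_pow_eq_one.mp h
  rw [← h4] at h5
  simpa using h5

/-- Let `G` be a finite cyclic group of order `p ^ n` (`p` prime) and `H' < H ≤ G`
subgroups.  For every `H`-equivariant function `f : G → H ⧸ H'` (meaning
`f (h * g) = h • f g`), with `G` acting by right translation `(γ • f) g = f (g * γ)`,
the stabilizer of `f` in `G` is exactly `H'`. -/
theorem stmt_4 {G : Type*} [CommGroup G] [Finite G] [IsCyclic G] (p n : ℕ)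
    (hp : p.Prime) (hG : Nat.card G = p ^ n) (H' H : Subgroup G) (hH'H : H' < H)
    (f : G → H ⧸ H'.subgroupOf H)
    (hf : ∀ (h : H) (g : G), f (↑h * g) = h • f g) :
    ∀ γ : G, (∀ g : G, f (g * γ) = f g) ↔ γ ∈ H' := by
  have key : ∀ γ ∈ H, ∀ g : G, f (g * γ) = f g ↔ γ ∈ H' := by
    intro γ hγ g
    have e : f (g * γ) = (⟨γ, hγ⟩ : H) • f g := by rw [mul_comm, ← hf]
    rw [e]
    obtain ⟨x, hx⟩ := QuotientGroup.mk_surjective (f g)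
    rw [← hx]
    change ((((⟨γ, hγ⟩ : H) * x : H) : H ⧸ H'.subgroupOf H) = _) ↔ _
    rw [eq_comm, QuotientGroup.eq, Subgroup.mem_subgroupOf, mul_comm (⟨γ, hγ⟩ : H) x,
      inv_mul_cancel_left]
  intro γ
  constructor
  · intro hγ
    by_cases hm : γ ∈ H
    · exact (key γ hm 1).mp (hγ 1)
    exfalso
    refine hH'H.not_ge fun h hh => ?_
    have hz : h ∈ Subgroup.zpowers γ := by
      obtain ⟨i, -, hi⟩ := (Nat.dvd_prime_pow hp).mp (hG ▸ orderOf_dvd_natCard γ)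
      obtain ⟨j, -, hj⟩ := (Nat.dvd_prime_pow hp).mp (hG ▸ orderOf_dvd_natCard h)
      rcases le_total i j with hij | hij
      · exact absurd ((Subgroup.zpowers_le.mpr hh) (mem_zpowers_of_orderOf_dvd' γ h
          (by rw [hi, hj]; exact pow_dvd_pow p hij))) hm
      · exact mem_zpowers_of_orderOf_dvd' h γ (by rw [hi, hj]; exact pow_dvd_pow p hij)
    classical
    rw [mem_zpowers_iff_mem_range_orderOf, Finset.mem_image] at hz
    obtain ⟨k, -, rfl⟩ := hz
    refine (key _ hh 1).mp ?_
    have : ∀ k : ℕ, ∀ g, f (g * γ ^ k) = f g := by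
      intro k
      induction k with
      | zero => simp
      | succ k ih => intro g; rw [pow_succ, ← mul_assoc, hγ, ih]
    exact this k 1
  · intro hγ g
    exact (key γ (hH'H.le hγ) g).mpr hγ
end

section
/- Let M be an abelian group and a, b ≥ 1 integers with n = a·b. Equip the group of functions M^(ℤ/n) = (ℤ/n → M) with the automorphism σ defined by (σ m)(t) = m(t − 1); equip M^(ℤ/a) with the automorphism ρ defined by (ρ v)(i) = v(i − 1); and equip (M^(ℤ/a))^(ℤ/b) with the automorphism τ defined by (τ w)(j) = w(j − 1) for j ≠ 0 and (τ w)(0) = ρ(w(b − 1)). Then the map Φ : M^(ℤ/n) → (M^(ℤ/a))^(ℤ/b) defined by Φ(m)(j)(i) = m(j + b·i) (computing j + b·i in ℤ/n from representatives 0 ≤ j < b and 0 ≤ i < a) is an isomorphism of abelian groups satisfying Φ ∘ σ = τ ∘ Φ; in particular τ has order dividing n and Φ is equivariant for the ℤ/n-actions generated by σ and τ. -/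
/-- The cyclic shift `(σ m) t = m (t - 1)` on functions `ZMod n → M`. -/
def shiftFun (M : Type*) (n : ℕ) (m : ZMod n → M) : ZMod n → M :=
  fun t => m (t - 1)

/-- The twisted block shift `τ` on `ZMod b → ZMod a → M`: `(τ w) j = w (j - 1)` for
`j ≠ 0`, and `(τ w) 0 = ρ (w (b - 1))` where `ρ` is the cyclic shift on `ZMod a → M`. -/
def blockShift (M : Type*) (a b : ℕ) (w : ZMod b → ZMod a → M) : ZMod b → ZMod a → M :=
  fun j => if j = 0 then shiftFun M a (w (((b - 1 : ℕ) : ZMod b))) else w (j - 1)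

/-- The reindexing map `Φ (m) j i = m (j + b * i)`, computed in `ZMod n` from the
representatives `0 ≤ j < b` and `0 ≤ i < a`. -/
def reindex (M : Type*) (a b n : ℕ) (m : ZMod n → M) : ZMod b → ZMod a → M :=
  fun j i => m (((j.val + b * i.val : ℕ) : ZMod n))

theorem aux_mul_val (a b n k : ℕ) (hn : n = a * b) :
    ((b * ((k : ZMod a)).val : ℕ) : ZMod n) = ((b * k : ℕ) : ZMod n) := by
  rw [ZMod.val_natCast, ZMod.natCast_eq_natCast_iff]
  subst hn
  rw [mul_comm a b]
  exact Nat.ModEq.mul_left' b (Nat.mod_modEq k a)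

theorem aux_inter (M : Type*) (a b n : ℕ) (ha : 1 ≤ a) (hb : 1 ≤ b) (hn : n = a * b)
    (m : ZMod n → M) :
    reindex M a b n (shiftFun M n m) = blockShift M a b (reindex M a b n m) := by
  have : NeZero a := ⟨by omega⟩
  have : NeZero b := ⟨by omega⟩
  funext j i
  unfold blockShift
  split_ifs with hj
  · subst hj
    simp only [reindex, shiftFun]
    congr 1
    have hi : i - 1 = ((i.val + (a - 1) : ℕ) : ZMod a) := by
      rw [Nat.cast_add, Nat.cast_sub ha, ZMod.natCast_zmod_val]
      simp [sub_eq_add_neg]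
    have h0 : ((a : ZMod n)) * (b : ZMod n) = 0 := by
      rw [← Nat.cast_mul, ← hn, ZMod.natCast_self]
    rw [hi, Nat.cast_add (ZMod.val ((b - 1 : ℕ) : ZMod b)), aux_mul_val a b n _ hn,
      ZMod.val_natCast, Nat.mod_eq_of_lt (by omega)]
    push_cast [Nat.cast_sub ha, Nat.cast_sub hb]
    simp only [ZMod.val_zero, Nat.cast_zero]
    linear_combination -h0
  · simp only [reindex, shiftFun]
    congr 1
    have hpos : 1 ≤ j.val := Nat.one_le_iff_ne_zero.mpr (by rwa [Ne, ZMod.val_eq_zero])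
    have hlt := ZMod.val_lt j
    have hj1 : j - 1 = ((j.val - 1 : ℕ) : ZMod b) := by
      rw [Nat.cast_sub hpos, ZMod.natCast_zmod_val, Nat.cast_one]
    rw [hj1, ZMod.val_natCast, Nat.mod_eq_of_lt (by omega)]
    push_cast [Nat.cast_sub hpos]
    ring

theorem aux_bij (M : Type*) (a b n : ℕ) (ha : 1 ≤ a) (hb : 1 ≤ b) (hn : n = a * b) :
    Function.Bijective (reindex M a b n) := by
  have : NeZero a := ⟨by omega⟩
  have : NeZero b := ⟨by omega⟩
  have : NeZero n := ⟨by rw [hn]; exact Nat.mul_ne_zero (by omega) (by omega)⟩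
  constructor
  · intro m m' h
    funext t
    have h1 := congrFun (congrFun h ((t.val : ℕ) : ZMod b)) ((t.val / b : ℕ) : ZMod a)
    simp only [reindex] at h1
    have h2 : (((((t.val : ℕ) : ZMod b)).val + b * (((t.val / b : ℕ) : ZMod a)).val : ℕ) : ZMod n)
        = t := by
      rw [Nat.cast_add, aux_mul_val a b n _ hn, ZMod.val_natCast, ← Nat.cast_add,
        Nat.mod_add_div, ZMod.natCast_zmod_val]
    rwa [h2] at h1
  · intro w
    refine ⟨fun t => w ((t.val : ℕ) : ZMod b) ((t.val / b : ℕ) : ZMod a), ?_⟩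
    funext j i
    simp only [reindex]
    have hj := ZMod.val_lt j
    have hi := ZMod.val_lt i
    have hlt : j.val + b * i.val < n := by
      rw [hn]
      nlinarith [Nat.mul_le_mul_left b (Nat.succ_le_of_lt hi)]
    rw [ZMod.val_natCast, Nat.mod_eq_of_lt hlt, Nat.add_mul_div_left _ _ (by omega),
      Nat.div_eq_of_lt hj]
    simp

theorem aux_shift_iter (M : Type*) (n k : ℕ) (m : ZMod n → M) :
    (shiftFun M n)^[k] m = fun t => m (t - k) := by
  induction k with
  | zero => simp
  | succ k ih =>
    rw [Function.iterate_succ_apply', ih]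
    funext t
    simp only [shiftFun]
    congr 1
    push_cast
    ring

/-- For an abelian group `M` and `n = a * b` with `a, b ≥ 1`, the reindexing map
`Φ : M ^ (ZMod n) → (M ^ (ZMod a)) ^ (ZMod b)` is an isomorphism of abelian groups
intertwining the cyclic shift `σ` with the twisted block shift `τ`; in particular `τ` has
order dividing `n` and `Φ` is equivariant for the `ℤ/n`-actions generated by `σ` and `τ`. -/
theorem stmt_8 (M : Type*) [AddCommGroup M] (a b n : ℕ) (ha : 1 ≤ a) (hb : 1 ≤ b)
    (hn : n = a * b) :
    Function.Bijective (reindex M a b n) ∧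
    (∀ m m' : ZMod n → M, reindex M a b n (m + m') = reindex M a b n m + reindex M a b n m') ∧
    (reindex M a b n) ∘ (shiftFun M n) = (blockShift M a b) ∘ (reindex M a b n) ∧
    (∀ w : ZMod b → ZMod a → M, (blockShift M a b)^[n] w = w) ∧
    (∀ k : ℕ, (reindex M a b n) ∘ (shiftFun M n)^[k] = (blockShift M a b)^[k] ∘ (reindex M a b n)) := by
  have hint := aux_inter M a b n ha hb hn
  have hsemi : Function.Semiconj (reindex M a b n) (shiftFun M n) (blockShift M a b) := hint
  have hbij := aux_bij M a b n ha hb hn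
  refine ⟨hbij, fun _ _ => rfl, funext hint, fun w => ?_, fun k => ?_⟩
  · obtain ⟨m, rfl⟩ := hbij.2 w
    rw [← (hsemi.iterate_right n).eq, aux_shift_iter]
    simp
  · exact (hsemi.iterate_right k).comp_eq
end

section
/- Let F be the free abelian group on generators {N_a : a ∈ ℤ/2}, let A = F ⊕ ℤ/2, and let T ≤ A be the subgroup generated by the elements (N_{a+b} − N_a − N_b, −a·b) for all a, b ∈ ℤ/2 (where a·b ∈ ℤ/2 is the product). Then the quotient group A/T is isomorphic to ℤ/4, generated by the class of (N_1, 0). -/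
/-- The Tambara reciprocity subgroup of `ℤ{N_a : a ∈ ℤ/2} ⊕ ℤ/2`, generated by the
elements `(N_{a+b} - N_a - N_b, -(a*b))` for `a b : ℤ/2`. -/
def trSubZMod2 : AddSubgroup (FreeAbelianGroup (ZMod 2) × ZMod 2) :=
  AddSubgroup.closure {z | ∃ a b : ZMod 2,
    z = (FreeAbelianGroup.of (a + b) - FreeAbelianGroup.of a - FreeAbelianGroup.of b,
          -(a * b))}

/-- The map to `ℤ/4` sending `N_a` to `a` and `tr(1)` to `2`. -/
def toZMod4 : (FreeAbelianGroup (ZMod 2) × ZMod 2) →+ ZMod 4 :=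
  AddMonoidHom.coprod (FreeAbelianGroup.lift (fun a : ZMod 2 => (a.val : ZMod 4)))
    { toFun := fun t => 2 * (t.val : ZMod 4)
      map_zero' := by decide
      map_add' := by decide }

lemma toZMod4_of (a t : ZMod 2) :
    toZMod4 (FreeAbelianGroup.of a, t) = (a.val : ZMod 4) + 2 * (t.val : ZMod 4) := by
  simp [toZMod4]

lemma trSub_le_ker : trSubZMod2 ≤ toZMod4.ker := by
  unfold trSubZMod2
  rw [AddSubgroup.closure_le]
  rintro z ⟨a, b, rfl⟩
  have h : toZMod4 (FreeAbelianGroup.of (a + b) - FreeAbelianGroup.of a - FreeAbelianGroup.of b,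
      -(a * b)) = ((a + b).val : ZMod 4) - a.val - b.val + 2 * ((-(a * b)).val : ZMod 4) := by
    simp [toZMod4]
  change toZMod4 _ = 0
  rw [h]
  revert a b
  decide

lemma trSub_rel (a b : ZMod 2) :
    (FreeAbelianGroup.of (a + b) - FreeAbelianGroup.of a - FreeAbelianGroup.of b, -(a * b))
      ∈ trSubZMod2 :=
  AddSubgroup.subset_closure ⟨a, b, rfl⟩

lemma mk_N0 : (QuotientAddGroup.mk (FreeAbelianGroup.of (0 : ZMod 2), (0 : ZMod 2)) :
    (FreeAbelianGroup (ZMod 2) × ZMod 2) ⧸ trSubZMod2) = 0 := by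
  rw [QuotientAddGroup.eq_zero_iff]
  have h := neg_mem (trSub_rel 0 0)
  simpa using h

lemma mk_t : (QuotientAddGroup.mk ((0 : FreeAbelianGroup (ZMod 2)), (1 : ZMod 2)) :
    (FreeAbelianGroup (ZMod 2) × ZMod 2) ⧸ trSubZMod2) =
    (2 : ℤ) • QuotientAddGroup.mk (FreeAbelianGroup.of (1 : ZMod 2), (0 : ZMod 2)) := by
  rw [← QuotientAddGroup.mk_zsmul, QuotientAddGroup.eq]
  have h0 := (QuotientAddGroup.eq_zero_iff _).1 mk_N0
  have h := sub_mem h0 (trSub_rel 1 1)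
  convert h using 1
  have e : (1 + 1 : ZMod 2) = 0 := by decide
  rw [e]
  ext
  · simp only [Prod.fst_add, Prod.fst_neg, Prod.fst_sub, Prod.smul_fst]; abel
  · simp

lemma four_N1 : (4 : ℤ) • (QuotientAddGroup.mk (FreeAbelianGroup.of (1 : ZMod 2), (0 : ZMod 2)) :
    (FreeAbelianGroup (ZMod 2) × ZMod 2) ⧸ trSubZMod2) = 0 := by
  rw [show (4 : ℤ) = 2 * 2 by norm_num, mul_zsmul, ← mk_t, ← QuotientAddGroup.mk_zsmul]
  have : (2 : ℤ) • ((0 : FreeAbelianGroup (ZMod 2)), (1 : ZMod 2)) = 0 := by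
    ext
    · simp
    · simp only [Prod.smul_snd, Prod.snd_zero]; decide
  rw [this]; rfl

/-- The inverse map. -/
def fromZMod4 : ZMod 4 →+ (FreeAbelianGroup (ZMod 2) × ZMod 2) ⧸ trSubZMod2 :=
  ZMod.lift 4 ⟨zmultiplesHom _
    (QuotientAddGroup.mk (FreeAbelianGroup.of (1 : ZMod 2), (0 : ZMod 2))), by
      simpa using four_N1⟩

lemma fromZMod4_int (n : ℤ) : fromZMod4 (n : ZMod 4) =
    n • QuotientAddGroup.mk (FreeAbelianGroup.of (1 : ZMod 2), (0 : ZMod 2)) := by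
  simp [fromZMod4]

/-- The induced map on the quotient. -/
def quotToZMod4 : (FreeAbelianGroup (ZMod 2) × ZMod 2) ⧸ trSubZMod2 →+ ZMod 4 :=
  QuotientAddGroup.lift _ toZMod4 trSub_le_ker

lemma quotToZMod4_mk (x : FreeAbelianGroup (ZMod 2) × ZMod 2) :
    quotToZMod4 (QuotientAddGroup.mk x) = toZMod4 x := rfl

lemma quot_N1 : quotToZMod4
    (QuotientAddGroup.mk (FreeAbelianGroup.of (1 : ZMod 2), (0 : ZMod 2))) = 1 := by
  rw [quotToZMod4_mk, toZMod4_of]; decide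

lemma right_inv4 : quotToZMod4.comp fromZMod4 = AddMonoidHom.id _ := by
  ext n
  obtain ⟨n, rfl⟩ := ZMod.intCast_surjective n
  rw [AddMonoidHom.comp_apply, fromZMod4_int, map_zsmul, quot_N1]
  simp

lemma left_inv4 : fromZMod4.comp quotToZMod4 = AddMonoidHom.id _ := by
  have d : ∀ a : ZMod 2, a = 0 ∨ a = 1 := by decide
  have key : ∀ x, fromZMod4 (toZMod4 x) = QuotientAddGroup.mk x := by
    have h : fromZMod4.comp toZMod4 = QuotientAddGroup.mk' trSubZMod2 := by
      refine AddMonoidHom.ext fun ⟨x, t⟩ => ?_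
      have hx : (x, t) = AddMonoidHom.inl _ (ZMod 2) x +
        AddMonoidHom.inr (FreeAbelianGroup (ZMod 2)) _ t := by simp
      rw [hx, map_add, map_add]
      congr 1
      · refine DFunLike.congr_fun (f := (fromZMod4.comp toZMod4).comp (AddMonoidHom.inl _ _))
          (g := (QuotientAddGroup.mk' trSubZMod2).comp (AddMonoidHom.inl _ _)) ?_ x
        ext a
        change fromZMod4 (toZMod4 (FreeAbelianGroup.of a, 0)) =
          QuotientAddGroup.mk (FreeAbelianGroup.of a, 0)
        rw [toZMod4_of]
        rcases d a with rfl | rfl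
        · rw [mk_N0]; simp
        · have := fromZMod4_int 1
          rw [one_zsmul] at this
          rw [← this]; congr 1
      · change fromZMod4 (toZMod4 (0, t)) = QuotientAddGroup.mk (0, t)
        rcases d t with rfl | rfl
        · change fromZMod4 (toZMod4 0) = 0
          simp
        · rw [mk_t, ← fromZMod4_int]
          congr 1
    exact fun x => DFunLike.congr_fun h x
  ext x
  · exact key _

/-- `(N^{C₂}_e ℤ/2)(C₂/C₂)`: the quotient of `ℤ{N_a : a ∈ ℤ/2} ⊕ ℤ/2` by the Tambara
reciprocity subgroup is isomorphic to `ℤ/4`, generated by the class of `(N_1, 0)`. -/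
theorem stmt_9 :
    ∃ e : (FreeAbelianGroup (ZMod 2) × ZMod 2) ⧸ trSubZMod2 ≃+ ZMod 4,
      e (QuotientAddGroup.mk (FreeAbelianGroup.of (1 : ZMod 2), (0 : ZMod 2))) = 1 := by
  exact ⟨AddMonoidHom.toAddEquiv quotToZMod4 fromZMod4 left_inv4 right_inv4, quot_N1⟩
end

section
/- For a commutative ring R, let F_R be the free abelian group on generators {N_a : a ∈ R}, let Q_R be the quotient of R ⊗_ℤ R by the subgroup generated by all x ⊗ y − y ⊗ x (writing [x ⊗ y] for images), and let A(R) := (F_R ⊕ Q_R)/T_R where T_R is the subgroup generated by all N_{a+b} − N_a − N_b − [a ⊗ b] for a, b ∈ R. Then there exists a unique commutative ring structure on A(R) whose addition is the quotient group addition, whose multiplicative identity is the class of N_1, and which satisfies [N_a]·[N_b] = [N_{a·b}], [N_a]·[x ⊗ y] = [a·x ⊗ a·y], and [x ⊗ y]·[z ⊗ w] = [x·z ⊗ y·w] + [x·w ⊗ y·z] for all a, b, x, y, z, w ∈ R. -/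
open scoped TensorProduct

/-- The subgroup of `M ⊗_ℤ M` generated by the elements `x ⊗ y - y ⊗ x`. -/
noncomputable def symSub (M : Type*) [AddCommGroup M] : AddSubgroup (TensorProduct ℤ M M) :=
  AddSubgroup.closure {z | ∃ x y : M, z = x ⊗ₜ[ℤ] y - y ⊗ₜ[ℤ] x}

/-- `Q_M`: the quotient of `M ⊗_ℤ M` by the subgroup generated by `x ⊗ y - y ⊗ x`. -/
abbrev QGrp (M : Type*) [AddCommGroup M] :=
  TensorProduct ℤ M M ⧸ symSub M

/-- The Tambara reciprocity subgroup `T_M ≤ F_M ⊕ Q_M`, generated by the elements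
`N_{a+b} - N_a - N_b - [a ⊗ b]`. -/
noncomputable def trSub (M : Type*) [AddCommGroup M] : AddSubgroup (FreeAbelianGroup M × QGrp M) :=
  AddSubgroup.closure {z | ∃ a b : M,
    z = (FreeAbelianGroup.of (a + b) - FreeAbelianGroup.of a - FreeAbelianGroup.of b,
          -(QuotientAddGroup.mk (a ⊗ₜ[ℤ] b)))}

/-- `A(M) = (F_M ⊕ Q_M) / T_M`, the top level of the norm construction `N^{C₂}_e M`. -/
abbrev AGrp (M : Type*) [AddCommGroup M] :=
  (FreeAbelianGroup M × QGrp M) ⧸ trSub M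

/-- The class `[N_a]` in `A(M)`. -/
noncomputable def Ncl {M : Type*} [AddCommGroup M] (a : M) : AGrp M :=
  QuotientAddGroup.mk (FreeAbelianGroup.of a, 0)

/-- The class `[x ⊗ y]` in `A(M)`. -/
noncomputable def Tcl {M : Type*} [AddCommGroup M] (x y : M) : AGrp M :=
  QuotientAddGroup.mk (0, QuotientAddGroup.mk (x ⊗ₜ[ℤ] y))

theorem agrp_lift {M : Type*} [AddCommGroup M] {B : Type*} [AddCommGroup B]
    (f : M → B) (g : M → M → B)
    (g1 : ∀ x y z, g (x + y) z = g x z + g y z)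
    (g2 : ∀ x y z, g x (y + z) = g x y + g x z)
    (g3 : ∀ x y, g x y = g y x)
    (hf : ∀ a b, f (a + b) = f a + f b + g a b) :
    ∃ φ : AGrp M →+ B, (∀ a, φ (Ncl a) = f a) ∧ (∀ x y, φ (Tcl x y) = g x y) := by
  let G : M →+ M →+ B := AddMonoidHom.mk' (fun x => AddMonoidHom.mk' (g x) (g2 x))
    (by intro x y; ext z; exact g1 x y z)
  have hG : ∀ x y, G x y = g x y := fun _ _ => rfl
  let T : TensorProduct ℤ M M →+ B := TensorProduct.liftAddHom G (by
    intro r m n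
    rw [map_zsmul, map_zsmul]; rfl)
  have hT : ∀ x y, T (x ⊗ₜ[ℤ] y) = g x y := fun x y => by
    simp only [T, TensorProduct.liftAddHom_tmul, hG]
  let Q : QGrp M →+ B := QuotientAddGroup.lift (symSub M) T (by
    rw [symSub, AddSubgroup.closure_le]
    rintro _ ⟨x, y, rfl⟩
    simp only [SetLike.mem_coe, AddMonoidHom.mem_ker, map_sub, hT]
    rw [g3, sub_self])
  have hQ : ∀ x y, Q (QuotientAddGroup.mk (x ⊗ₜ[ℤ] y)) = g x y := fun x y => hT x y
  let P : FreeAbelianGroup M × QGrp M →+ B := (FreeAbelianGroup.lift f).coprod Q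
  let A : AGrp M →+ B := QuotientAddGroup.lift (trSub M) P (by
    rw [trSub, AddSubgroup.closure_le]
    rintro _ ⟨a, b, rfl⟩
    simp only [SetLike.mem_coe, AddMonoidHom.mem_ker, P, AddMonoidHom.coprod_apply, map_sub,
      map_neg, FreeAbelianGroup.lift_apply_of, hQ, hf]
    abel)
  refine ⟨A, fun a => ?_, fun x y => ?_⟩
  · change P (FreeAbelianGroup.of a, 0) = f a
    simp [P]
  · change P (0, QuotientAddGroup.mk (x ⊗ₜ[ℤ] y)) = g x y
    simp only [P, AddMonoidHom.coprod_apply, map_zero, hQ, zero_add]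

theorem Tcl_add_left {M : Type*} [AddCommGroup M] (x y z : M) :
    Tcl (x + y) z = Tcl x z + Tcl y z := by
  simp only [Tcl, TensorProduct.add_tmul]
  rw [← QuotientAddGroup.mk_add, Prod.mk_add_mk, add_zero, QuotientAddGroup.mk_add]

theorem Tcl_comm {M : Type*} [AddCommGroup M] (x y : M) : Tcl x y = Tcl y x := by
  have : (QuotientAddGroup.mk (x ⊗ₜ[ℤ] y) : QGrp M) = QuotientAddGroup.mk (y ⊗ₜ[ℤ] x) := by
    rw [QuotientAddGroup.eq, neg_add_eq_sub]
    exact AddSubgroup.subset_closure ⟨y, x, rfl⟩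
  rw [Tcl, Tcl, this]

theorem Tcl_add_right {M : Type*} [AddCommGroup M] (x y z : M) :
    Tcl x (y + z) = Tcl x y + Tcl x z := by
  rw [Tcl_comm, Tcl_add_left, Tcl_comm y, Tcl_comm z]

theorem Ncl_add {M : Type*} [AddCommGroup M] (a b : M) :
    Ncl (a + b) = Ncl a + Ncl b + Tcl a b := by
  symm
  simp only [Ncl, Tcl]
  rw [← QuotientAddGroup.mk_add, ← QuotientAddGroup.mk_add, QuotientAddGroup.eq]
  refine AddSubgroup.subset_closure ⟨a, b, ?_⟩
  ext1
  · simp; abel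
  · simp

theorem agrp_ind {M : Type*} [AddCommGroup M] {p : AGrp M → Prop}
    (hN : ∀ a, p (Ncl a)) (hT : ∀ x y, p (Tcl x y))
    (h0 : p 0) (hadd : ∀ x y, p x → p y → p (x + y)) (hneg : ∀ x, p x → p (-x)) :
    ∀ x, p x := by
  intro x
  obtain ⟨⟨u, q⟩, rfl⟩ := QuotientAddGroup.mk_surjective x
  have e : ((u, q) : FreeAbelianGroup M × QGrp M) = (u, 0) + (0, q) := by simp
  rw [e, QuotientAddGroup.mk_add]
  apply hadd
  · have key : ∀ u : FreeAbelianGroup M, p (((AddMonoidHom.inl _ (QGrp M)) u :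
        FreeAbelianGroup M × QGrp M) : AGrp M) := by
      intro u
      induction u using FreeAbelianGroup.induction_on with
      | zero => rw [map_zero]; exact h0
      | of a => exact hN a
      | neg a h => rw [map_neg, QuotientAddGroup.mk_neg]; exact hneg _ h
      | add a b ha hb => rw [map_add, QuotientAddGroup.mk_add]; exact hadd _ _ ha hb
    exact key u
  · obtain ⟨t, rfl⟩ := QuotientAddGroup.mk_surjective q
    have key : ∀ t : TensorProduct ℤ M M, p (((AddMonoidHom.inr (FreeAbelianGroup M) (QGrp M))
        (QuotientAddGroup.mk t) : FreeAbelianGroup M × QGrp M) : AGrp M) := by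
      intro t
      induction t using TensorProduct.induction_on with
      | zero => rw [QuotientAddGroup.mk_zero, map_zero]; exact h0
      | tmul x y => exact hT x y
      | add a b ha hb =>
        rw [QuotientAddGroup.mk_add, map_add, QuotientAddGroup.mk_add]; exact hadd _ _ ha hb
    exact key t

theorem agrp_ext {M : Type*} [AddCommGroup M] {B : Type*} [AddCommGroup B] {f g : AGrp M →+ B}
    (hN : ∀ a, f (Ncl a) = g (Ncl a)) (hT : ∀ x y, f (Tcl x y) = g (Tcl x y)) : f = g := by
  apply AddMonoidHom.ext
  refine agrp_ind hN hT (by simp) ?_ ?_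
  · intro x y hx hy; rw [map_add, map_add, hx, hy]
  · intro x hx; rw [map_neg, map_neg, hx]

theorem agrp_mul (R : Type*) [CommRing R] : ∃ m : AGrp R →+ AGrp R →+ AGrp R,
    (∀ a b : R, m (Ncl a) (Ncl b) = Ncl (a * b)) ∧
    (∀ a x y : R, m (Ncl a) (Tcl x y) = Tcl (a * x) (a * y)) ∧
    (∀ a x y : R, m (Tcl x y) (Ncl a) = Tcl (a * x) (a * y)) ∧
    (∀ x y z w : R, m (Tcl x y) (Tcl z w) = Tcl (x * z) (y * w) + Tcl (x * w) (y * z)) := by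
  have h1 : ∀ a : R, ∃ φ : AGrp R →+ AGrp R, (∀ b, φ (Ncl b) = Ncl (a * b)) ∧
      (∀ x y, φ (Tcl x y) = Tcl (a * x) (a * y)) := by
    intro a
    apply agrp_lift
    · intro x y z; rw [mul_add, Tcl_add_left]
    · intro x y z; rw [mul_add, Tcl_add_right]
    · intro x y; rw [Tcl_comm]
    · intro x y; rw [mul_add, Ncl_add]
  have h2 : ∀ x y : R, ∃ φ : AGrp R →+ AGrp R, (∀ a, φ (Ncl a) = Tcl (a * x) (a * y)) ∧
      (∀ z w, φ (Tcl z w) = Tcl (x * z) (y * w) + Tcl (x * w) (y * z)) := by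
    intro x y
    apply agrp_lift
    · intro a b c; simp only [mul_add, Tcl_add_left, Tcl_add_right]; abel
    · intro a b c; simp only [mul_add, Tcl_add_left, Tcl_add_right]; abel
    · intro a b; rw [add_comm]
    · intro a b
      simp only [add_mul, Tcl_add_left, Tcl_add_right]
      simp only [mul_comm x, mul_comm y]
      rw [Tcl_comm (b * x) (a * y)]
      abel
  choose f f1 f2 using h1
  choose g g1 g2 using h2
  obtain ⟨m, m1, m2⟩ := agrp_lift f g
    (by intro x y z
        apply agrp_ext
        · intro a; simp only [AddMonoidHom.add_apply, g1, mul_add, Tcl_add_left]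
        · intro a b
          simp only [AddMonoidHom.add_apply, g2, add_mul, Tcl_add_left]; abel)
    (by intro x y z
        apply agrp_ext
        · intro a; simp only [AddMonoidHom.add_apply, g1, mul_add, Tcl_add_right]
        · intro a b
          simp only [AddMonoidHom.add_apply, g2, add_mul, Tcl_add_right]; abel)
    (by intro x y
        apply agrp_ext
        · intro a; simp only [g1]; rw [Tcl_comm]
        · intro a b
          simp only [g2]
          rw [add_comm, Tcl_comm (x * b), Tcl_comm (x * a)])
    (by intro a b
        apply agrp_ext
        · intro c
          simp only [AddMonoidHom.add_apply, f1, g1, add_mul, Ncl_add, mul_comm c]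
        · intro x y
          simp only [AddMonoidHom.add_apply, f2, g2, add_mul, Tcl_add_left, Tcl_add_right]
          rw [Tcl_comm (b * x) (a * y)]
          abel)
  refine ⟨m, ?_, ?_, ?_, ?_⟩
  · intro a b; rw [m1, f1]
  · intro a b c; rw [m1, f2]
  · intro a b c; rw [m2, g1]
  · intro a b c d; rw [m2, g2]

theorem agrp_ext2 {M : Type*} [AddCommGroup M] {B : Type*} [AddCommGroup B]
    {f g : AGrp M →+ AGrp M →+ B}
    (h1 : ∀ a b, f (Ncl a) (Ncl b) = g (Ncl a) (Ncl b))
    (h2 : ∀ a x y, f (Ncl a) (Tcl x y) = g (Ncl a) (Tcl x y))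
    (h3 : ∀ a x y, f (Tcl x y) (Ncl a) = g (Tcl x y) (Ncl a))
    (h4 : ∀ x y z w, f (Tcl x y) (Tcl z w) = g (Tcl x y) (Tcl z w)) : f = g :=
  agrp_ext (fun a => agrp_ext (h1 a) (h2 a)) (fun x y => agrp_ext (fun a => h3 a x y) (h4 x y))

/-- For a commutative ring `R`, there is a unique commutative ring structure on `A(R)`
whose addition is the quotient addition, whose multiplicative identity is the class of
`N_1`, and which satisfies `[N_a]·[N_b] = [N_{ab}]`, `[N_a]·[x ⊗ y] = [ax ⊗ ay]`, and
`[x ⊗ y]·[z ⊗ w] = [xz ⊗ yw] + [xw ⊗ yz]`. -/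
theorem stmt_11 (R : Type*) [CommRing R] :
    ∃! mul : AGrp R → AGrp R → AGrp R,
      (∀ x y z : AGrp R, mul (x + y) z = mul x z + mul y z) ∧
      (∀ x y z : AGrp R, mul x (y + z) = mul x y + mul x z) ∧
      (∀ x y : AGrp R, mul x y = mul y x) ∧
      (∀ x y z : AGrp R, mul (mul x y) z = mul x (mul y z)) ∧
      (∀ x : AGrp R, mul (Ncl (1 : R)) x = x) ∧
      (∀ a b : R, mul (Ncl a) (Ncl b) = Ncl (a * b)) ∧
      (∀ a x y : R, mul (Ncl a) (Tcl x y) = Tcl (a * x) (a * y)) ∧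
      (∀ x y z w : R,
        mul (Tcl x y) (Tcl z w) = Tcl (x * z) (y * w) + Tcl (x * w) (y * z)) := by
  obtain ⟨m, m1, m2, m3, m4⟩ := agrp_mul R
  refine ⟨fun x y => m x y, ⟨?_, ?_, ?_, ?_, ?_, m1, m2, m4⟩, ?_⟩
  · intro x y z; simp only [map_add, AddMonoidHom.add_apply]
  · intro x y z; simp only [map_add]
  · have : m = m.flip := by
      apply agrp_ext2
      · intro a b; simp only [AddMonoidHom.flip_apply, m1, mul_comm]
      · intro a b c; simp only [AddMonoidHom.flip_apply, m2, m3]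
      · intro a b c; simp only [AddMonoidHom.flip_apply, m2, m3]
      · intro x y z w
        simp only [AddMonoidHom.flip_apply, m4]
        rw [Tcl_comm (x * w), mul_comm x z, mul_comm y w, mul_comm x w, mul_comm y z]
    intro x y
    exact DFunLike.congr_fun (DFunLike.congr_fun this x) y
  · intro x y z
    dsimp only
    -- both sides as trilinear maps, checked on generators
    revert x
    refine agrp_ind (fun a => ?_) (fun a b => ?_) (by simp)
      (by intro x x' h h'; simp only [map_add, AddMonoidHom.add_apply, h, h'])
      (by intro x h; simp only [map_neg, AddMonoidHom.neg_apply, h])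
    all_goals
      revert y
      refine agrp_ind (fun c => ?_) (fun c d => ?_) (by simp)
        (by intro x x' h h'; simp only [map_add, AddMonoidHom.add_apply, h, h'])
        (by intro x h; simp only [map_neg, AddMonoidHom.neg_apply, h])
    all_goals
      revert z
      refine agrp_ind (fun e => ?_) (fun e f => ?_) (by simp)
        (by intro x x' h h'; simp only [map_add, h, h'])
        (by intro x h; simp only [map_neg, h])
    all_goals simp only [m1, m2, m3, m4, map_add, AddMonoidHom.add_apply]
    · rw [mul_assoc]
    · simp only [mul_assoc]
    · simp only [mul_left_comm]
    · simp only [mul_assoc]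
    · simp only [mul_comm, mul_left_comm]
    · simp only [mul_comm, mul_left_comm]
    · simp only [mul_comm, mul_left_comm]
    · rw [Tcl_comm (a * (c * f)) (b * (d * e)), Tcl_comm (a * (d * e)) (b * (c * f))]
      simp only [mul_assoc]
      rw [Tcl_comm (b * (d * e)), Tcl_comm (b * (c * f))]
      abel
  · intro x
    have : m (Ncl 1) = AddMonoidHom.id _ := by
      apply agrp_ext
      · intro a; simp [m1]
      · intro a b; simp [m2]
    dsimp only
    rw [this]; rfl
  · rintro mul ⟨a1, a2, a3, -, -, n1, n2, n4⟩
    let m' : AGrp R →+ AGrp R →+ AGrp R :=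
      AddMonoidHom.mk' (fun x => AddMonoidHom.mk' (mul x) (a2 x))
        (by intro x y; apply AddMonoidHom.ext; intro z; exact a1 x y z)
    have hm' : ∀ x y, m' x y = mul x y := fun _ _ => rfl
    have : m' = m := by
      apply agrp_ext2
      · intro a b; rw [hm', n1, m1]
      · intro a b c; rw [hm', n2, m2]
      · intro a b c; rw [hm', a3, n2, m3]
      · intro x y z w; rw [hm', n4, m4]
    funext x y
    rw [← hm', this]
end

section
/- For an abelian group M, let A(M) := (F_M ⊕ Q_M)/T_M as in the norm construction. Then there is a unique group homomorphism res : A(M) → M ⊗_ℤ M satisfying res[N_a] = a ⊗ a for all a ∈ M and res[x ⊗ y] = x ⊗ y + y ⊗ x for all x, y ∈ M. Moreover, every element in the image of res is fixed by the swap automorphism of M ⊗_ℤ M (the automorphism induced by x ⊗ y ↦ y ⊗ x). -/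
open scoped TensorProduct

/-- Homomorphisms out of `A(M)` are determined on the generators. -/
theorem AGrp_hom_ext {M : Type*} [AddCommGroup M] {G : Type*} [AddCommGroup G]
    (f g : AGrp M →+ G) (hN : ∀ a : M, f (Ncl a) = g (Ncl a))
    (hT : ∀ x y : M, f (Tcl x y) = g (Tcl x y)) : f = g := by
  have h1 : ∀ p : FreeAbelianGroup M,
      f (QuotientAddGroup.mk (p, 0)) = g (QuotientAddGroup.mk (p, 0)) := by
    have : (f.comp (QuotientAddGroup.mk' (trSub M))).comp (AddMonoidHom.inl _ _)
        = (g.comp (QuotientAddGroup.mk' (trSub M))).comp (AddMonoidHom.inl _ _) := by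
      apply FreeAbelianGroup.lift_ext
      intro a
      exact hN a
    intro p
    exact DFunLike.congr_fun this p
  have h2 : ∀ q : QGrp M,
      f (QuotientAddGroup.mk (0, q)) = g (QuotientAddGroup.mk (0, q)) := by
    intro q
    obtain ⟨t, rfl⟩ := QuotientAddGroup.mk_surjective q
    have : ((f.comp (QuotientAddGroup.mk' (trSub M))).comp (AddMonoidHom.inr _ _)).comp
          (QuotientAddGroup.mk' (symSub M))
        = ((g.comp (QuotientAddGroup.mk' (trSub M))).comp (AddMonoidHom.inr _ _)).comp
          (QuotientAddGroup.mk' (symSub M)) := by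
      refine DFunLike.ext _ _ fun t => ?_
      induction t using TensorProduct.induction_on with
      | zero => rw [map_zero, map_zero]
      | tmul x y => exact hT x y
      | add a b ha hb => rw [map_add, map_add, ha, hb]
    exact DFunLike.congr_fun this t
  refine DFunLike.ext _ _ fun u => ?_
  obtain ⟨⟨p, q⟩, rfl⟩ := QuotientAddGroup.mk_surjective u
  have e : (QuotientAddGroup.mk (p, q) : AGrp M)
      = QuotientAddGroup.mk (p, 0) + QuotientAddGroup.mk (0, q) := by
    rw [← QuotientAddGroup.mk_add]
    simp
  rw [e, map_add, map_add, h1, h2]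

/-- The symmetrization `Q_M → M ⊗ M`. -/
noncomputable def symHom (M : Type*) [AddCommGroup M] : QGrp M →+ TensorProduct ℤ M M :=
  QuotientAddGroup.lift (symSub M)
    (AddMonoidHom.id _ + (TensorProduct.comm ℤ M M).toLinearMap.toAddMonoidHom) (by
      rw [symSub, AddSubgroup.closure_le]
      rintro z ⟨x, y, rfl⟩
      simp [AddMonoidHom.mem_ker])

theorem symHom_mk {M : Type*} [AddCommGroup M] (x y : M) :
    symHom M (QuotientAddGroup.mk (x ⊗ₜ[ℤ] y)) = x ⊗ₜ[ℤ] y + y ⊗ₜ[ℤ] x := by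
  rfl

/-- The restriction map. -/
noncomputable def resHom (M : Type*) [AddCommGroup M] : AGrp M →+ TensorProduct ℤ M M :=
  QuotientAddGroup.lift (trSub M)
    ((FreeAbelianGroup.lift (fun a : M => a ⊗ₜ[ℤ] a)).coprod (symHom M)) (by
      rw [trSub, AddSubgroup.closure_le]
      rintro z ⟨a, b, rfl⟩
      simp only [SetLike.mem_coe, AddMonoidHom.mem_ker, AddMonoidHom.coprod_apply, map_sub,
        map_neg, FreeAbelianGroup.lift_apply_of, symHom_mk, TensorProduct.add_tmul,
        TensorProduct.tmul_add]
      abel)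

theorem resHom_N {M : Type*} [AddCommGroup M] (a : M) : resHom M (Ncl a) = a ⊗ₜ[ℤ] a := by
  change ((FreeAbelianGroup.lift (fun a : M => a ⊗ₜ[ℤ] a)).coprod (symHom M))
    (FreeAbelianGroup.of a, 0) = _
  simp

theorem resHom_T {M : Type*} [AddCommGroup M] (x y : M) :
    resHom M (Tcl x y) = x ⊗ₜ[ℤ] y + y ⊗ₜ[ℤ] x := by
  change ((FreeAbelianGroup.lift (fun a : M => a ⊗ₜ[ℤ] a)).coprod (symHom M))
    (0, QuotientAddGroup.mk (x ⊗ₜ[ℤ] y)) = _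
  simp [symHom_mk]

/-- There is a unique group homomorphism `res : A(M) → M ⊗_ℤ M` with `res [N_a] = a ⊗ a`
and `res [x ⊗ y] = x ⊗ y + y ⊗ x`, and every element of its image is fixed by the swap
automorphism of `M ⊗_ℤ M`. -/
theorem stmt_13 (M : Type*) [AddCommGroup M] :
    (∃! res : AGrp M →+ TensorProduct ℤ M M,
      (∀ a : M, res (Ncl a) = a ⊗ₜ[ℤ] a) ∧
      (∀ x y : M, res (Tcl x y) = x ⊗ₜ[ℤ] y + y ⊗ₜ[ℤ] x)) ∧
    (∀ res : AGrp M →+ TensorProduct ℤ M M,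
      ((∀ a : M, res (Ncl a) = a ⊗ₜ[ℤ] a) ∧
       (∀ x y : M, res (Tcl x y) = x ⊗ₜ[ℤ] y + y ⊗ₜ[ℤ] x)) →
      ∀ u : AGrp M, TensorProduct.comm ℤ M M (res u) = res u) := by
  refine ⟨⟨resHom M, ⟨resHom_N, resHom_T⟩, ?_⟩, ?_⟩
  · rintro f ⟨hN, hT⟩
    apply AGrp_hom_ext
    · intro a
      rw [hN, resHom_N]
    · intro x y
      rw [hT, resHom_T]
  · rintro f ⟨hN, hT⟩ u
    have : ((TensorProduct.comm ℤ M M).toLinearMap.toAddMonoidHom).comp f = f := by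
      apply AGrp_hom_ext
      · intro a
        simp [hN]
      · intro x y
        simp [hT, add_comm]
    exact DFunLike.congr_fun this u
end
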